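/- In the minimum-counterexample setup, for every acyclic edge coloring c of G−xy using Δ+1 colors, |F''_x(c)| = 2, i.e., the edges from x to its neighbors of degree at least 3 receive exactly two colors. -/

import Mathlib

open SimpleGraph

namespace AEC

variable {V : Type*}

/-- The set of colors appearing (under partial coloring `c`) on colored edges incident
with the vertex `u` (i.e. `F_u`). -/
def colorsAt (G : SimpleGraph V) (c : Sym2 V → Option ℕ) (u : V) : Set ℕ :=
  {γ | ∃ z, G.Adj u z ∧ c s(u, z) = some γ}

/-- `S_ab`: the set of colors appearing on the colored edges incident with `b`
other than the edge `ab`. -/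
def Sset (G : SimpleGraph V) (c : Sym2 V → Option ℕ) (a b : V) : Set ℕ :=
  {γ | ∃ z, G.Adj b z ∧ z ≠ a ∧ c s(b, z) = some γ}

/-- A partial edge coloring (colors are `ℕ`, `none` = uncolored): it may only color
edges of `G`, and colored edges sharing an endpoint receive distinct colors. -/
def ProperPartialColoring (G : SimpleGraph V) (c : Sym2 V → Option ℕ) : Prop :=
  (∀ e, (c e).isSome → e ∈ G.edgeSet) ∧
  ∀ ⦃u v w : V⦄, G.Adj u v → G.Adj u w → v ≠ w → (c s(u, v)).isSome →
    c s(u, v) ≠ c s(u, w)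

/-- A valid (acyclic) partial coloring: proper, and no cycle of `G` is bichromatic,
i.e. no cycle has all of its edges colored using only two colors. -/
def AcyclicPartialColoring (G : SimpleGraph V) (c : Sym2 V → Option ℕ) : Prop :=
  ProperPartialColoring G c ∧
  ∀ (α β : ℕ) (v : V) (W : G.Walk v v), W.IsCycle →
    ¬ ∀ e ∈ W.edges, c e = some α ∨ c e = some β

/-- An acyclic edge coloring of `G` using (at most) `k` colors: a valid partial coloring
that colors every edge of `G` with a color `< k`. -/
def IsAcyclicEdgeColoring (G : SimpleGraph V) (k : ℕ) (c : Sym2 V → Option ℕ) : Prop :=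
  AcyclicPartialColoring G c ∧ ∀ e ∈ G.edgeSet, ∃ a, a < k ∧ c e = some a

/-- `G` is 2-degenerate: every nonempty (induced) subgraph has a vertex of degree at most 2. -/
def TwoDegenerate [DecidableEq V] (G : SimpleGraph V) [DecidableRel G.Adj] : Prop :=
  ∀ s : Finset V, s.Nonempty → ∃ v ∈ s, (s.filter fun u => G.Adj v u).card ≤ 2

/-- A maximal `(α,β)`-bichromatic path from `a` to `b`: a path all of whose edges are
colored `α` or `β`, which cannot be extended at either end. -/
def IsMaximalBichromaticPath (G : SimpleGraph V) (c : Sym2 V → Option ℕ)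
    (α β : ℕ) {a b : V} (W : G.Walk a b) : Prop :=
  W.IsPath ∧ (∀ e ∈ W.edges, c e = some α ∨ c e = some β) ∧
  (∀ w, G.Adj a w → (c s(a, w) = some α ∨ c s(a, w) = some β) → w ∈ W.support) ∧
  (∀ w, G.Adj b w → (c s(b, w) = some α ∨ c s(b, w) = some β) → w ∈ W.support)

/-- An `(α,β,a,b)`-maximal bichromatic path: a maximal `(α,β)`-bichromatic path from
`a` to `b` whose edge incident on `a` is colored `α`. -/
def IsMaxBichromaticPathFrom (G : SimpleGraph V) (c : Sym2 V → Option ℕ)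
    (α β : ℕ) {a b : V} (W : G.Walk a b) : Prop :=
  IsMaximalBichromaticPath G c α β W ∧ ∃ e, W.edges.head? = some e ∧ c e = some α

/-- An `(α,β,ab)`-critical path: a maximal `(α,β)`-bichromatic path from `a` to `b` whose
edges incident on `a` and on `b` are both colored `α`. -/
def IsCriticalPath (G : SimpleGraph V) (c : Sym2 V → Option ℕ)
    (α β : ℕ) {a b : V} (W : G.Walk a b) : Prop :=
  IsMaxBichromaticPathFrom G c α β W ∧ ∃ e, W.edges.getLast? = some e ∧ c e = some α

/-- `F''_x(c)`: colors of edges from `x` to its neighbors (other than `y`) of degree ≥ 3. -/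
def Fpp [Fintype V] (G : SimpleGraph V) [DecidableRel G.Adj]
    (c : Sym2 V → Option ℕ) (x y : V) : Set ℕ :=
  {γ | ∃ z, G.Adj x z ∧ z ≠ y ∧ 3 ≤ G.degree z ∧ c s(x, z) = some γ}

/-- `F'_x(c)`: colors of edges from `x` to its neighbors (other than `y`) of degree 2. -/
def Fp [Fintype V] (G : SimpleGraph V) [DecidableRel G.Adj]
    (c : Sym2 V → Option ℕ) (x y : V) : Set ℕ :=
  {γ | ∃ z, G.Adj x z ∧ z ≠ y ∧ G.degree z = 2 ∧ c s(x, z) = some γ}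

/-- `F_x(c) = F'_x(c) ∪ F''_x(c)`. -/
def Fx [Fintype V] (G : SimpleGraph V) [DecidableRel G.Adj]
    (c : Sym2 V → Option ℕ) (x y : V) : Set ℕ :=
  Fp G c x y ∪ Fpp G c x y

/-- In a cycle, every edge `vu` is followed at `v` by a second edge of the cycle. -/
lemma exists_ne_mem_edges_of_isCycle {G : SimpleGraph V} {r u v : V} {W : G.Walk r r}
    (hW : W.IsCycle) (h : s(v, u) ∈ W.edges) : ∃ w, w ≠ u ∧ G.Adj v w ∧ s(v, w) ∈ W.edges := by
  have h2 := hW.ncard_neighborSet_toSubgraph_eq_two (W.fst_mem_support_of_mem_edges h)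
  obtain ⟨w, hw, hne⟩ := Set.exists_ne_of_one_lt_ncard
    (s := W.toSubgraph.neighborSet v) (by omega) u
  rw [Subgraph.mem_neighborSet, ← Subgraph.mem_edgeSet, Walk.mem_edges_toSubgraph] at hw
  exact ⟨w, hne, W.adj_of_mem_edges hw, hw⟩

/-- Giving the edge `uv` a color `γ` missing at both ends preserves acyclicity, as long as no
cycle through `uv` becomes bichromatic. -/
lemma IsAcyclicEdgeColoring.update [DecidableEq V] {G H : SimpleGraph V} {k γ : ℕ} {u v : V}
    {c : Sym2 V → Option ℕ} (hc : IsAcyclicEdgeColoring H k c) (hHG : H ≤ G)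
    (hGH : ∀ e ∈ G.edgeSet, e ≠ s(u, v) → e ∈ H.edgeSet) (huv : G.Adj u v) (hγ : γ < k)
    (hu : ∀ w, G.Adj u w → w ≠ v → c s(u, w) ≠ some γ)
    (hv : ∀ w, G.Adj v w → w ≠ u → c s(v, w) ≠ some γ)
    (hcyc : ∀ (α β : ℕ) (r : V) (W : G.Walk r r), W.IsCycle → s(u, v) ∈ W.edges →
      ¬ ∀ e ∈ W.edges, Function.update c s(u, v) (some γ) e = some α ∨
        Function.update c s(u, v) (some γ) e = some β) :
    IsAcyclicEdgeColoring G k (Function.update c s(u, v) (some γ)) := by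
  obtain ⟨⟨⟨hsupp, hprop⟩, hac⟩, htot⟩ := hc
  have hfresh : ∀ p q w, s(p, q) = s(u, v) → G.Adj p w → s(p, w) ≠ s(u, v) →
      c s(p, w) ≠ some γ := by
    intro p q w hpq hpw hne
    rcases Sym2.eq_iff.1 hpq with ⟨rfl, rfl⟩ | ⟨rfl, rfl⟩
    · exact hu w hpw (by rintro rfl; exact hne rfl)
    · exact hv w hpw (by rintro rfl; exact hne Sym2.eq_swap)
  refine ⟨⟨⟨?_, ?_⟩, ?_⟩, ?_⟩
  · intro e he
    by_cases h : e = s(u, v)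
    · subst h; exact huv
    · rw [Function.update_of_ne h] at he
      exact SimpleGraph.edgeSet_mono hHG (hsupp e he)
  · intro p q w hpq hpw hqw hs
    have hne : s(p, q) ≠ s(p, w) := fun h => hqw (Sym2.congr_right.1 h)
    by_cases h1 : s(p, q) = s(u, v)
    · have h2 : s(p, w) ≠ s(u, v) := fun h => hne (h1.trans h.symm)
      rw [h1, Function.update_self, Function.update_of_ne h2]
      exact (hfresh p q w h1 hpw h2).symm
    · by_cases h2 : s(p, w) = s(u, v)
      · rw [h2, Function.update_self, Function.update_of_ne h1]
        exact hfresh p w q h2 hpq h1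
      · rw [Function.update_of_ne h1] at hs ⊢
        rw [Function.update_of_ne h2]
        exact hprop (hGH s(p, q) hpq h1) (hGH s(p, w) hpw h2) hqw hs
  · intro α β r W hW hbi
    by_cases hmem : s(u, v) ∈ W.edges
    · exact hcyc α β r W hW hmem hbi
    · have hne : ∀ e ∈ W.edges, e ≠ s(u, v) := fun e he h => hmem (h ▸ he)
      have hH : ∀ e ∈ W.edges, e ∈ H.edgeSet := fun e he =>
        hGH e (W.edges_subset_edgeSet he) (hne e he)
      refine hac α β r (W.transfer H hH) (hW.transfer hH) fun e he => ?_
      rw [Walk.edges_transfer] at he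
      simpa only [Function.update_of_ne (hne e he)] using hbi e he
  · intro e he
    by_cases h : e = s(u, v)
    · exact ⟨γ, hγ, by rw [h, Function.update_self]⟩
    · rw [Function.update_of_ne h]
      exact htot e (hGH e he h)

/-- The colors on the edges from `u` to neighbors other than `v` are fewer than the degree
of `u`. -/
lemma exists_finset_colors_card_lt [Fintype V] [DecidableEq V] (G : SimpleGraph V)
    [DecidableRel G.Adj] (c : Sym2 V → Option ℕ) {u v : V} (huv : G.Adj u v) :
    ∃ S : Finset ℕ, S.card < G.degree u ∧
      ∀ w γ, G.Adj u w → w ≠ v → c s(u, w) = some γ → γ ∈ S := by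
  refine ⟨((G.neighborFinset u).erase v).image fun w => (c s(u, w)).getD 0, ?_, ?_⟩
  · refine Finset.card_image_le.trans_lt ?_
    rw [← G.card_neighborFinset_eq_degree]
    exact Finset.card_erase_lt_of_mem (by simpa using huv)
  · intro w γ hw hne hγ
    exact Finset.mem_image.2 ⟨w, by simp [hw, hne], by simp [hγ]⟩

lemma exists_lt_notMem_of_card_lt {S : Finset ℕ} {k : ℕ} (h : S.card < k) :
    ∃ γ < k, γ ∉ S := by
  obtain ⟨γ, hγ, hS⟩ := Finset.exists_mem_notMem_of_card_lt_card
    (s := S) (t := Finset.range k) (by simpa using h)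
  exact ⟨γ, Finset.mem_range.1 hγ, hS⟩

lemma eq_or_eq_of_degree_eq_two [Fintype V] {G : SimpleGraph V} [DecidableRel G.Adj]
    {y x y' w : V} (hy : G.degree y = 2) (hx : G.Adj y x) (hy' : G.Adj y y') (hne : y' ≠ x)
    (hw : G.Adj y w) : w = x ∨ w = y' := by
  classical
  have h : ({x, y'} : Finset V) = G.neighborFinset y := by
    refine Finset.eq_of_subset_of_card_le ?_ ?_
    · intro z hz
      rcases Finset.mem_insert.1 hz with rfl | hz
      · simpa using hx
      · rw [Finset.mem_singleton.1 hz]; simpa using hy'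
    · rw [G.card_neighborFinset_eq_degree, hy, Finset.card_pair hne.symm]
  have : w ∈ ({x, y'} : Finset V) := by rw [h]; simpa using hw
  simpa using this

/-- If the color of `yy'` does not appear on an edge from `x` to a neighbor of degree at least
three, an acyclic edge coloring of `G - xy` extends to `G`. -/
lemma exists_extension_of_notMem_Fpp [Fintype V] [DecidableEq V] (G : SimpleGraph V)
    [DecidableRel G.Adj] {x y y' : V} (hxy : G.Adj x y) (hy2 : G.degree y = 2)
    (hyy' : G.Adj y y') (hy'x : y' ≠ x) {c : Sym2 V → Option ℕ}
    (hc : IsAcyclicEdgeColoring (G.deleteEdges {s(x, y)}) (G.maxDegree + 1) c)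
    {a : ℕ} (ha : c s(y, y') = some a) (haF : a ∉ Fpp G c x y) :
    ∃ c' : Sym2 V → Option ℕ, IsAcyclicEdgeColoring G (G.maxDegree + 1) c' := by
  have hprop := hc.1.1.2
  obtain ⟨S, hS, hSmem⟩ := exists_finset_colors_card_lt G c hxy
  have hadj : ∀ {p q}, G.Adj p q → s(p, q) ≠ s(x, y) → (G.deleteEdges {s(x, y)}).Adj p q :=
    fun h hne => by simpa [SimpleGraph.deleteEdges_adj] using ⟨h, by simpa using hne⟩
  have hedge : ∀ {z}, z ≠ y → s(x, z) ≠ s(x, y) := fun hz h => hz (Sym2.congr_right.1 h)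
  obtain ⟨E, hE, haE, hEmem⟩ : ∃ E : Finset ℕ, E.card ≤ 1 ∧ (a ∈ S ∪ E) ∧
      ∀ z w γ, G.Adj x z → z ≠ y → c s(x, z) = some a → G.Adj z w → w ≠ x →
        c s(z, w) = some γ → γ ∈ E := by
    by_cases hz : ∃ z, G.Adj x z ∧ z ≠ y ∧ c s(x, z) = some a
    · obtain ⟨z, hxz, hzy, hza⟩ := hz
      have hdeg : G.degree z < 3 := by
        by_contra! h
        exact haF ⟨z, hxz, hzy, h, hza⟩
      obtain ⟨E, hE, hEm⟩ := exists_finset_colors_card_lt G c hxz.symm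
      refine ⟨E, by omega, Finset.mem_union_left _ (hSmem z a hxz hzy hza), ?_⟩
      intro z₁ w γ hxz₁ hzy₁ hza₁ hw hwx hγ
      obtain rfl : z₁ = z := by
        by_contra hne
        exact hprop (hadj hxz₁ (hedge hzy₁)) (hadj hxz (hedge hzy)) hne (by simp [hza₁])
          (hza₁.trans hza.symm)
      exact hEm w γ hw hwx hγ
    · refine ⟨{a}, by simp, by simp, ?_⟩
      intro z w γ hxz hzy hza
      exact absurd ⟨z, hxz, hzy, hza⟩ hz
  obtain ⟨γ, hγ, hγmem⟩ := exists_lt_notMem_of_card_lt (S := S ∪ E) (k := G.maxDegree + 1) (by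
    have h1 := Finset.card_union_le S E
    have h2 := G.degree_le_maxDegree x
    omega)
  have hγa : γ ≠ a := fun h => hγmem (h ▸ haE)
  have hγx : ∀ w, G.Adj x w → w ≠ y → c s(x, w) ≠ some γ := fun w hw hne h =>
    hγmem (Finset.mem_union_left _ (hSmem w γ hw hne h))
  refine ⟨_, hc.update (u := x) (v := y) (γ := γ) (SimpleGraph.deleteEdges_le _) ?_ hxy hγ hγx
    ?_ ?_⟩
  · intro e he hne
    simpa [SimpleGraph.edgeSet_deleteEdges] using ⟨he, hne⟩
  · intro w hw hne
    rcases eq_or_eq_of_degree_eq_two hy2 hxy.symm hyy' hy'x hw with rfl | rfl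
    · exact absurd rfl hne
    · rw [ha]
      simpa using hγa.symm
  · intro α β r W hW hmem hbi
    have hyy'ne : s(y, y') ≠ s(x, y) := by
      rw [Sym2.eq_swap (a := x)]
      exact fun h => hy'x (Sym2.congr_right.1 h)
    have hcol : ∀ e ∈ W.edges, Function.update c s(x, y) (some γ) e = some a ∨
        Function.update c s(x, y) (some γ) e = some γ := by
      obtain ⟨w, hwx, hyw, hw⟩ := exists_ne_mem_edges_of_isCycle (u := x) (v := y) hW
        (by rwa [Sym2.eq_swap])
      obtain rfl : w = y' :=
        (eq_or_eq_of_degree_eq_two hy2 hxy.symm hyy' hy'x hyw).resolve_left hwx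
      have h1 := hbi _ hmem
      have h2 := hbi _ hw
      rw [Function.update_self] at h1
      rw [Function.update_of_ne hyy'ne, ha] at h2
      intro e he
      have h3 := hbi e he
      simp only [Option.some.injEq] at h1 h2
      grind
    obtain ⟨z, hzy, hxz, hz⟩ := exists_ne_mem_edges_of_isCycle hW hmem
    have hza : c s(x, z) = some a := by
      have := hcol _ hz
      rw [Function.update_of_ne (hedge hzy)] at this
      exact this.resolve_right (hγx z hxz hzy)
    obtain ⟨w, hwx, hzw, hw⟩ := exists_ne_mem_edges_of_isCycle (u := x) (v := z) hW
      (by rwa [Sym2.eq_swap])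
    have hzwne : s(z, w) ≠ s(x, y) := by
      intro h
      rcases Sym2.eq_iff.1 h with ⟨rfl, -⟩ | ⟨rfl, -⟩
      · exact hxz.ne rfl
      · exact hzy rfl
    have hzw' := hcol _ hw
    rw [Function.update_of_ne hzwne] at hzw'
    have hzxne : s(z, x) ≠ s(x, y) := by
      rw [Sym2.eq_swap]; exact hedge hzy
    rcases hzw' with h | h
    · refine hprop (hadj hzw hzwne) (hadj hxz.symm hzxne) hwx (by simp [h]) ?_
      rw [h, Sym2.eq_swap (a := z), hza]
    · exact hγmem (Finset.mem_union_right _ (hEmem z w γ hxz hzy hza hzw hwx h))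

/-- Lemma 3: in the minimum-counterexample setup, for every acyclic edge
coloring `c` of `G − xy` with `Δ+1` colors, `|F''_x(c)| = 2`. -/
theorem Fpp_card_eq_two
    {V : Type*} [Fintype V] [DecidableEq V] (G : SimpleGraph V) [DecidableRel G.Adj]
    (h2deg : TwoDegenerate G)
    (hmin : ¬ ∃ c : Sym2 V → Option ℕ, IsAcyclicEdgeColoring G (G.maxDegree + 1) c)
    (hdel : ∀ e ∈ G.edgeSet, ∃ c : Sym2 V → Option ℕ,
      IsAcyclicEdgeColoring (G.deleteEdges {e}) (G.maxDegree + 1) c)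
    (x : V)
    (hxdeg2 : ∃ z, G.Adj x z ∧ G.degree z = 2)
    (hxdeg3 : ((G.neighborFinset x).filter fun z => 3 ≤ G.degree z).card ≤ 2)
    (y y' : V) (hxy : G.Adj x y) (hy2 : G.degree y = 2)
    (hyy' : G.Adj y y') (hy'x : y' ≠ x)
    (c : Sym2 V → Option ℕ)
    (hc : IsAcyclicEdgeColoring (G.deleteEdges {s(x, y)}) (G.maxDegree + 1) c) :
    (Fpp G c x y).ncard = 2 := by
  have hsub : Fpp G c x y ⊆ ↑(((G.neighborFinset x).filter fun z => 3 ≤ G.degree z).image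
      fun z => (c s(x, z)).getD 0) := by
    rintro γ ⟨z, hz, -, hd, hγ⟩
    exact Finset.mem_coe.2 (Finset.mem_image.2 ⟨z, by simp [hz, hd], by simp [hγ]⟩)
  have hfin : (Fpp G c x y).Finite := (Finset.finite_toSet _).subset hsub
  have hle : (Fpp G c x y).ncard ≤ 2 := by
    refine (Set.ncard_le_ncard hsub (Finset.finite_toSet _)).trans ?_
    rw [Set.ncard_coe_finset]
    exact Finset.card_image_le.trans hxdeg3
  refine le_antisymm hle ?_
  by_contra! hlt
  have hyy'ne : s(y, y') ≠ s(x, y) := by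
    rw [Sym2.eq_swap (a := x)]
    exact fun h => hy'x (Sym2.congr_right.1 h)
  obtain ⟨S, hS, hSmem⟩ := exists_finset_colors_card_lt G c hyy'.symm
  obtain ⟨b, hb, hbmem⟩ := exists_lt_notMem_of_card_lt (S := S ∪ hfin.toFinset)
    (k := G.maxDegree + 1) (by
      have h1 := Finset.card_union_le S hfin.toFinset
      have h2 := G.degree_le_maxDegree y'
      rw [← Set.ncard_eq_toFinset_card _ hfin] at h1
      omega)
  rw [Finset.mem_union, not_or, Set.Finite.mem_toFinset] at hbmem
  have hnbr : ∀ w, (G.deleteEdges {s(x, y)}).Adj y w → w = y' := by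
    intro w hw
    rw [SimpleGraph.deleteEdges_adj] at hw
    refine (eq_or_eq_of_degree_eq_two hy2 hxy.symm hyy' hy'x hw.1).resolve_left ?_
    rintro rfl
    exact hw.2 (by simp [Sym2.eq_swap])
  have hc' : IsAcyclicEdgeColoring (G.deleteEdges {s(x, y)}) (G.maxDegree + 1)
      (Function.update c s(y, y') (some b)) := by
    refine hc.update le_rfl (fun e he _ => he) ?_ hb ?_ ?_ ?_
    · rw [SimpleGraph.deleteEdges_adj]
      exact ⟨hyy', by simpa using hyy'ne⟩
    · exact fun w hw hne => absurd (hnbr w hw) hne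
    · intro w hw hne h
      exact hbmem.1 (hSmem w b (SimpleGraph.deleteEdges_le _ hw) hne h)
    · intro α β r W hW hmem
      obtain ⟨w, hne, hw, -⟩ := exists_ne_mem_edges_of_isCycle hW hmem
      exact absurd (hnbr w hw) hne
  refine hmin (exists_extension_of_notMem_Fpp G hxy hy2 hyy' hy'x hc'
    (Function.update_self ..) ?_)
  rintro ⟨z, hxz, hzy, hd, hz⟩
  rw [Function.update_of_ne] at hz
  · exact hbmem.2 ⟨z, hxz, hzy, hd, hz⟩
  · intro h
    rcases Sym2.eq_iff.1 h with ⟨rfl, -⟩ | ⟨rfl, -⟩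
    · exact hxy.ne rfl
    · exact hy'x rfl

end AEC
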